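/- Let ε > 0 and let Q(n,ε) be the number of cyclically reduced words w of length n such that for every pair x, y ∈ Σ with y ≠ x^{-1}, the Whitehead graph edge label satisfies ŵ_{xy}/n ∈ (1/(k(2k−1)) − ε, 1/(k(2k−1)) + ε). Then Q(n,ε)/γ(n,C) → 1 as n → ∞, and the convergence is exponentially fast (there exist K > 0 and 0 < σ < 1 with |1 − Q(n,ε)/γ(n,C)| ≤ K σ^n). -/

import Mathlib

/-! Common definitions: free group `FG k = F(a_1,…,a_k)`, reduced and cyclically
reduced words, Whitehead automorphisms, strict minimality, counting functions and
exponential genericity, following Kapovich–Schupp–Shpilrain. -/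

/-- The free group of rank `k` on the basis `a_1,…,a_k`. -/
abbrev FG (k : ℕ) := FreeGroup (Fin k)

/-- The alphabet `Σ = {a_1,…,a_k}^{±1}`: a letter is a basis index together with a sign. -/
abbrev Letter (k : ℕ) := Fin k × Bool

/-- The inverse of a letter. -/
def linv {k : ℕ} (x : Letter k) : Letter k := (x.1, !x.2)

/-- The length `|g|` of the reduced word representing `g`. -/
def wordLength {k : ℕ} (g : FG k) : ℕ := (FreeGroup.toWord g).length

/-- A word is (freely) reduced if it equals its free reduction. -/
def ReducedWord {k : ℕ} (w : List (Letter k)) : Prop := FreeGroup.reduce w = w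

/-- A word is cyclically reduced if all of its cyclic permutations are reduced;
equivalently, `w ++ w` is reduced. -/
def CyclicallyReducedWord {k : ℕ} (w : List (Letter k)) : Prop :=
  FreeGroup.reduce (w ++ w) = w ++ w

/-- An element of `FG k` is cyclically reduced if its reduced word is. -/
def IsCyclicallyReduced {k : ℕ} (g : FG k) : Prop :=
  CyclicallyReducedWord (FreeGroup.toWord g)

/-- `C`, the set of all cyclically reduced elements of `FG k`. -/
def Cset (k : ℕ) : Set (FG k) := {g | IsCyclicallyReduced g}

/-- The cyclic length `‖g‖`: the length of the cyclically reduced form of `g`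
(the unique cyclically reduced `u` with `g = x u x⁻¹`). -/
noncomputable def cyclicLength {k : ℕ} (g : FG k) : ℕ :=
  sInf {n | ∃ x u : FG k, IsCyclicallyReduced u ∧ g = x * u * x⁻¹ ∧ wordLength u = n}

/-- The set `Σ = {a_1,…,a_k}^{±1}` inside the free group. -/
def letterSet (k : ℕ) : Set (FG k) :=
  {g | ∃ i : Fin k, g = FreeGroup.of i ∨ g = (FreeGroup.of i)⁻¹}

/-- A Whitehead automorphism of the first kind: a relabeling automorphism,
i.e. one whose restriction to `Σ` is a permutation of `Σ`. -/
def IsRelabeling {k : ℕ} (τ : MulAut (FG k)) : Prop :=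
  (⇑τ) '' letterSet k = letterSet k

/-- A Whitehead automorphism of the second kind, with multiplier `a ∈ Σ`:
`τ a = a` and `τ x ∈ {x, xa, a⁻¹x, a⁻¹xa}` for all `x ∈ Σ`. -/
def IsWhitehead2 {k : ℕ} (τ : MulAut (FG k)) : Prop :=
  ∃ a ∈ letterSet k, τ a = a ∧
    ∀ x ∈ letterSet k, τ x = x ∨ τ x = x * a ∨ τ x = a⁻¹ * x ∨ τ x = a⁻¹ * x * a

/-- An automorphism is inner if it is conjugation by some element. -/
def IsInner {k : ℕ} (α : MulAut (FG k)) : Prop := ∃ g : FG k, α = MulAut.conj g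

/-- `SM`: the set of strictly minimal cyclically reduced elements, those `w` with
`‖τ w‖ > |w|` for every non-inner Whitehead automorphism `τ` of the second kind. -/
def SM (k : ℕ) : Set (FG k) :=
  {w | IsCyclicallyReduced w ∧
    ∀ τ : MulAut (FG k), IsWhitehead2 τ → ¬ IsInner τ → wordLength w < cyclicLength (τ w)}

/-- `SM'`: elements whose cyclically reduced form lies in `SM`. -/
def SM' (k : ℕ) : Set (FG k) := {g | ∃ x u : FG k, u ∈ SM k ∧ g = x * u * x⁻¹}

/-- `γ(n,S)`: the number of elements of `S` of length `n`. -/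
noncomputable def gammaC {k : ℕ} (S : Set (FG k)) (n : ℕ) : ℕ :=
  {g ∈ S | wordLength g = n}.ncard

/-- `ρ(n,S)`: the number of elements of `S` of length at most `n`. -/
noncomputable def rhoC {k : ℕ} (S : Set (FG k)) (n : ℕ) : ℕ :=
  {g ∈ S | wordLength g ≤ n}.ncard

/-- `B ⊆ S` is exponentially generic in `S` if `ρ(n,B)/ρ(n,S) → 1`
exponentially fast. -/
def ExpGenericIn {k : ℕ} (B S : Set (FG k)) : Prop :=
  B ⊆ S ∧ ∃ K : ℝ, 0 < K ∧ ∃ σ : ℝ, 0 < σ ∧ σ < 1 ∧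
    ∀ n : ℕ, |1 - (rhoC B n : ℝ) / (rhoC S n : ℝ)| ≤ K * σ ^ n

/-- `B` is exponentially negligible in `S` if `S \ B` is exponentially generic in `S`. -/
def ExpNegligibleIn {k : ℕ} (B S : Set (FG k)) : Prop := ExpGenericIn (S \ B) S

/-- The orbit `Aut(F_k) w`. -/
def autOrbit {k : ℕ} (w : FG k) : Set (FG k) := {g | ∃ α : MulAut (FG k), α w = g}

/-- `u` is a cyclic permutation of `v`: the reduced word of `u` is a rotation of
the reduced word of `v`. -/
def IsCyclicPerm {k : ℕ} (u v : FG k) : Prop :=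
  ∃ n : ℕ, FreeGroup.toWord u = (FreeGroup.toWord v).rotate n

/-- `w` is a proper power: `w = uⁿ` for some `n ≥ 2`. -/
def IsProperPower {k : ℕ} (w : FG k) : Prop := ∃ (u : FG k) (n : ℕ), 2 ≤ n ∧ w = u ^ n

/-- `TS`: strictly minimal cyclically reduced `w` which are not proper powers and
are not conjugate to `τ w` for any nontrivial relabeling automorphism `τ`. -/
def TS (k : ℕ) : Set (FG k) :=
  {w | w ∈ SM k ∧ ¬ IsProperPower w ∧
    ∀ τ : MulAut (FG k), IsRelabeling τ → τ ≠ 1 → ¬ IsConj (τ w) w}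

/-- `TS'`: elements whose cyclically reduced form lies in `TS`. -/
def TS' (k : ℕ) : Set (FG k) := {g | ∃ x u : FG k, u ∈ TS k ∧ g = x * u * x⁻¹}

/-- `Z`: elements of `TS` such that no relabeling automorphism sends `w` to a cyclic
permutation of `w⁻¹`. -/
def Zset (k : ℕ) : Set (FG k) :=
  {w | w ∈ TS k ∧ ¬ ∃ τ : MulAut (FG k), IsRelabeling τ ∧ IsCyclicPerm (τ w) w⁻¹}

/-- Growth entropy `H(S) = limsup ρ(n,S)^{1/n}`. -/
noncomputable def entropyH {k : ℕ} (S : Set (FG k)) : ℝ :=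
  Filter.limsup (fun n : ℕ => (rhoC S n : ℝ) ^ ((n : ℝ)⁻¹)) Filter.atTop

/-- Number of occurrences of the two-letter word `xy` as a subword of `w`. -/
def countPair {k : ℕ} (w : List (Letter k)) (x y : Letter k) : ℕ :=
  (w.zip w.tail).count (x, y)

/-- The label `ŵ_{xy}` of the edge `[x⁻¹, y]` in the weighted Whitehead graph of the
cyclically reduced word `w`: occurrences of `xy` and of `y⁻¹x⁻¹` in `wc`, where `c` is
the first letter of `w`. -/
def whLabel {k : ℕ} (w : List (Letter k)) (x y : Letter k) : ℕ :=
  countPair (w ++ w.take 1) x y + countPair (w ++ w.take 1) (linv y) (linv x)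

/-- The one-relator group `G_u = ⟨a_1,…,a_k ∣ u = 1⟩`. -/
abbrev OneRel (k : ℕ) (u : FG k) := FG k ⧸ Subgroup.normalClosure ({u} : Set (FG k))

/-- `u` is primitive: it belongs to some free basis of `FG k`, equivalently it is the
image of a basis element under an automorphism. -/
def IsPrimitive {k : ℕ} (u : FG k) : Prop :=
  ∃ (α : MulAut (FG k)) (i : Fin k), α (FreeGroup.of i) = u

section WH
open Finset

def whNb {k : ℕ} (z : Letter k) : Finset (Letter k) := Finset.univ.filter (fun y => y ≠ linv z)

def whT {k : ℕ} : ℕ → Letter k → Finset (List (Letter k))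
  | 0, _ => {[]}
  | (n+1), z => (whNb z).biUnion (fun y => (whT n y).image (List.cons y))

def whSum {k : ℕ} (g : Letter k → Letter k → ℝ) : Letter k → List (Letter k) → ℝ
  | _, [] => 0
  | z, (y :: v) => g z y + whSum g y v

lemma linv_linv {k : ℕ} (x : Letter k) : linv (linv x) = x := by simp [linv]

lemma linv_ne {k : ℕ} (x : Letter k) : linv x ≠ x := by
  obtain ⟨i, b⟩ := x
  simp [linv]

lemma linv_eq_iff {k : ℕ} (x y : Letter k) : linv x = y ↔ x = linv y := by
  constructor
  · rintro rfl; rw [linv_linv]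
  · rintro rfl; rw [linv_linv]

lemma mem_whT {k : ℕ} (n : ℕ) (z : Letter k) (v : List (Letter k)) :
    v ∈ whT n z ↔ v.length = n ∧ List.IsChain (fun a b => b ≠ linv a) (z :: v) := by
  induction n generalizing z v with
  | zero => 
    simp only [whT, Finset.mem_singleton, List.length_eq_zero_iff]
    constructor
    · rintro rfl; simp
    · exact fun h => h.1
  | succ n ih =>
    cases v with
    | nil => simp [whT]
    | cons y v =>
      simp only [whT, Finset.mem_biUnion, Finset.mem_image, whNb, Finset.mem_filter,
        Finset.mem_univ, true_and, List.cons.injEq, List.length_cons, List.isChain_cons_cons]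
      constructor
      · rintro ⟨a, ha, u, hu, rfl, rfl⟩
        have := (ih _ _).1 hu
        exact ⟨by omega, ha, this.2⟩
      · rintro ⟨h1, h2, h3⟩
        exact ⟨y, h2, v, (ih _ _).2 ⟨by omega, h3⟩, rfl, rfl⟩

lemma sum_whT_succ {k : ℕ} (n : ℕ) (z : Letter k) (F : List (Letter k) → ℝ) :
    ∑ v ∈ whT (n+1) z, F v = ∑ y ∈ whNb z, ∑ v ∈ whT n y, F (y :: v) := by
  rw [whT, Finset.sum_biUnion]
  · refine Finset.sum_congr rfl fun y _ => ?_
    rw [Finset.sum_image]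
    intro a _ b _ h
    simpa using h
  · intro a _ b _ hab
    simp only [Function.onFun]
    rw [Finset.disjoint_left]
    intro l h1 h2
    simp only [Finset.mem_image] at h1 h2
    obtain ⟨u, _, rfl⟩ := h1
    obtain ⟨u', _, h⟩ := h2
    simp at h
    exact hab h.1.symm

lemma card_whNb {k : ℕ} (z : Letter k) : ((whNb z).card : ℝ) = 2 * k - 1 := by
  have h : whNb z = Finset.univ.erase (linv z) := by
    ext a; simp [whNb]
  have hk : 0 < k := lt_of_le_of_lt (Nat.zero_le _) z.1.2
  rw [h, Finset.card_erase_of_mem (Finset.mem_univ _)]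
  simp only [Finset.card_univ, Fintype.card_prod, Fintype.card_fin, Fintype.card_bool]
  rw [Nat.cast_sub (by omega)]
  push_cast; ring

lemma card_whT {k : ℕ} (n : ℕ) (z : Letter k) : ((whT n z).card : ℝ) = (2 * k - 1) ^ n := by
  induction n generalizing z with
  | zero => simp [whT]
  | succ n ih =>
    have := sum_whT_succ n z (fun _ => 1)
    simp only [Finset.sum_const, nsmul_eq_mul, mul_one] at this
    rw [this, Finset.sum_congr rfl (fun y _ => ih y)]
    rw [Finset.sum_const, nsmul_eq_mul, card_whNb]; ring

lemma whSum_bound {k : ℕ} (g : Letter k → Letter k → ℝ) (A : ℝ)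
    (hg : ∀ z, ∑ y ∈ whNb z, Real.exp (g z y) ≤ A) (hA : 0 ≤ A) (n : ℕ) (z : Letter k) :
    ∑ v ∈ whT n z, Real.exp (whSum g z v) ≤ A ^ n := by
  induction n generalizing z with
  | zero => simp [whT, whSum]
  | succ n ih =>
    rw [sum_whT_succ]
    calc _ = ∑ y ∈ whNb z, Real.exp (g z y) * ∑ v ∈ whT n y, Real.exp (whSum g y v) := by
          refine Finset.sum_congr rfl fun y _ => ?_
          rw [Finset.mul_sum]
          refine Finset.sum_congr rfl fun v _ => ?_
          rw [whSum, Real.exp_add]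
      _ ≤ ∑ y ∈ whNb z, Real.exp (g z y) * A ^ n := by
          gcongr with y _
          exact ih y
      _ = (∑ y ∈ whNb z, Real.exp (g z y)) * A ^ n := by rw [Finset.sum_mul]
      _ ≤ A * A ^ n := by gcongr; exact hg z
      _ = A ^ (n+1) := by ring

/-- corrector -/
noncomputable def whH {k : ℕ} (x z : Letter k) : ℝ :=
  (if z = x then (2 * (k:ℝ) - 1) / (2 * k * (2 * k - 2)) else 0)
    + (if z = linv x then -1 / (2 * (k:ℝ) * (2 * k - 2)) else 0)

noncomputable def whG {k : ℕ} (x y a b : Letter k) : ℝ :=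
  (if (a, b) = (x, y) then 1 else 0) - 1 / (2 * (k:ℝ) * (2 * k - 1)) + whH x b - whH x a

lemma whG_sum {k : ℕ} (hk : 2 ≤ k) (x y : Letter k) (hxy : y ≠ linv x) (z : Letter k) :
    ∑ b ∈ whNb z, whG x y z b = 0 := by
  have hk' : (2:ℝ) ≤ k := by exact_mod_cast hk
  have hS : ∑ b ∈ whNb z, whH x b = ∑ b, whH x b - whH x (linv z) := by
    have h : whNb z = Finset.univ.erase (linv z) := by
      ext a; simp [whNb]
    rw [h, ← Finset.add_sum_erase _ _ (Finset.mem_univ (linv z))]; ring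
  have hS2 : ∑ b, whH x b = 1 / (2 * (k:ℝ)) := by
    simp only [whH, Finset.sum_add_distrib, Finset.sum_ite_eq', Finset.mem_univ, if_true]
    have : (2 * (k:ℝ) - 2) ≠ 0 := by linarith
    have : ((k:ℝ) - 1) ≠ 0 := by linarith
    field_simp; ring
  have hI : ∑ b ∈ whNb z, (if (z, b) = (x, y) then (1:ℝ) else 0) = if z = x then 1 else 0 := by
    by_cases h : z = x
    · subst h
      simp [whNb, hxy]
    · simp [h]
  have : ∑ b ∈ whNb z, whG x y z b = (if z = x then 1 else 0)
      - (2 * k - 1) * (1 / (2 * (k:ℝ) * (2 * k - 1))) + (1 / (2 * (k:ℝ)) - whH x (linv z))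
      - (2 * k - 1) * whH x z := by
    simp only [whG, Finset.sum_sub_distrib, Finset.sum_add_distrib, hI, hS, hS2, Finset.sum_const,
      nsmul_eq_mul, card_whNb]
  rw [this]
  have e1 : (2 * (k:ℝ) - 2) ≠ 0 := by linarith
  have e2 : (2 * (k:ℝ) - 1) ≠ 0 := by linarith
  have e3 : (k:ℝ) ≠ 0 := by linarith
  have e4 : (k:ℝ) - 1 ≠ 0 := by linarith
  by_cases h : z = x
  · subst h
    simp [whH, linv_ne, (linv_ne z).symm]
    field_simp; ring
  · by_cases h2 : z = linv x
    · subst h2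
      simp [whH, linv_ne, linv_linv, (linv_ne x).symm]
      field_simp; ring
    · have h3 : linv z ≠ x := by rw [Ne, linv_eq_iff]; exact h2
      have h4 : linv z ≠ linv x := by rw [Ne, linv_eq_iff, linv_linv]; exact h
      simp [whH, h, h2, h3, h4]
      field_simp; ring

lemma whH_abs {k : ℕ} (hk : 2 ≤ k) (x z : Letter k) : |whH x z| ≤ 1 := by
  have hk' : (2:ℝ) ≤ k := by exact_mod_cast hk
  have hp : 0 < 2 * (k:ℝ) * (2 * k - 2) := by
    apply mul_pos <;> linarith
  unfold whH
  by_cases h : z = x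
  · subst h
    simp only [if_true, (linv_ne z).symm, if_false, add_zero]
    rw [abs_div, abs_of_pos hp, div_le_one hp, abs_le]
    constructor <;> nlinarith
  · by_cases h2 : z = linv x
    · simp only [h, h2, if_true, linv_ne, if_false, zero_add]
      rw [abs_div, abs_of_pos hp, div_le_one hp, abs_le]
      constructor <;> nlinarith
    · simp [h, h2]

lemma whG_abs {k : ℕ} (hk : 2 ≤ k) (x y a b : Letter k) : |whG x y a b| ≤ 3 := by
  have hk' : (2:ℝ) ≤ k := by exact_mod_cast hk
  have h1 := abs_le.1 (whH_abs hk x a)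
  have h2 := abs_le.1 (whH_abs hk x b)
  have hp : 1 ≤ 2 * (k:ℝ) * (2 * k - 1) := by nlinarith
  have h3 : 1 / (2 * (k:ℝ) * (2 * k - 1)) ≤ 1 := by
    rw [div_le_one (by linarith)]; exact hp
  have h4 : 0 ≤ 1 / (2 * (k:ℝ) * (2 * k - 1)) := by
    apply div_nonneg <;> linarith
  unfold whG
  rw [abs_le]
  split_ifs <;> constructor <;> linarith

lemma whG_exp {k : ℕ} (hk : 2 ≤ k) (x y : Letter k) (hxy : y ≠ linv x) (θ : ℝ)
    (hθ : |θ| ≤ 1 / 3) (z : Letter k) :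
    ∑ b ∈ whNb z, Real.exp (θ * whG x y z b) ≤ (2 * k - 1) * Real.exp (9 * θ ^ 2) := by
  have key : ∀ b, Real.exp (θ * whG x y z b) ≤ 1 + 9 * θ ^ 2 + θ * whG x y z b := by
    intro b
    have hb := whG_abs hk x y z b
    have h1 : |θ * whG x y z b| ≤ 1 := by
      rw [abs_mul]
      calc _ ≤ (1/3 : ℝ) * 3 := by gcongr
        _ = 1 := by norm_num
    have h2 := (abs_le.1 (Real.abs_exp_sub_one_sub_id_le h1)).2
    have h3 : (whG x y z b)^2 ≤ 9 := by
      rw [← sq_abs]; nlinarith [abs_nonneg (whG x y z b)]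
    have h4 : (θ * whG x y z b)^2 ≤ 9 * θ^2 := by
      rw [mul_pow]; nlinarith [sq_nonneg θ]
    linarith
  calc _ ≤ ∑ b ∈ whNb z, (1 + 9 * θ ^ 2 + θ * whG x y z b) := Finset.sum_le_sum fun b _ => key b
    _ = (2 * k - 1) * (1 + 9 * θ ^ 2) := by
      rw [Finset.sum_add_distrib, ← Finset.mul_sum, whG_sum hk x y hxy, Finset.sum_const,
        nsmul_eq_mul, card_whNb]; ring
    _ ≤ _ := by
      have hk' : (2:ℝ) ≤ k := by exact_mod_cast hk
      have := Real.add_one_le_exp (9 * θ^2)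
      gcongr
      · linarith
      · linarith

lemma whSum_eq {k : ℕ} (x y : Letter k) (θ : ℝ) (z : Letter k) (v : List (Letter k)) :
    whSum (fun a b => θ * whG x y a b) z v
      = θ * ((countPair (z :: v) x y : ℝ) - 1 / (2 * (k:ℝ) * (2 * k - 1)) * v.length
          + whH x ((z :: v).getLast (by simp)) - whH x z) := by
  induction v generalizing z with
  | nil => simp [whSum, countPair]
  | cons b v ih =>
    have hc : (countPair (z :: b :: v) x y : ℝ)
        = countPair (b :: v) x y + (if (z, b) = (x, y) then 1 else 0) := by
      simp only [countPair, List.tail_cons, List.zip_cons_cons, List.count_cons]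
      push_cast
      simp
    have hl : (z :: b :: v).getLast (by simp) = (b :: v).getLast (by simp) :=
      List.getLast_cons (by simp)
    rw [whSum, ih, hc, hl]
    simp only [whG, List.length_cons]
    push_cast
    ring

open Classical in
lemma whBad_card {k : ℕ} (hk : 2 ≤ k) (x y : Letter k) (hxy : y ≠ linv x) (θ : ℝ)
    (hθ : |θ| ≤ 1 / 3) (c : ℝ) (z : Letter k) (n : ℕ) :
    (((whT n z).filter (fun v => (z :: v).getLast (by simp) = z ∧
      c * n ≤ θ * ((countPair (z :: v) x y : ℝ) - 1 / (2 * (k:ℝ) * (2 * k - 1)) * n))).card : ℝ)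
      ≤ (2 * k - 1) ^ n * Real.exp (9 * θ ^ 2 - c) ^ n := by
  have hk' : (2:ℝ) ≤ k := by exact_mod_cast hk
  set B := (whT n z).filter (fun v => (z :: v).getLast (by simp) = z ∧
      c * n ≤ θ * ((countPair (z :: v) x y : ℝ) - 1 / (2 * (k:ℝ) * (2 * k - 1)) * n)) with hB
  have h1 := whSum_bound (fun a b => θ * whG x y a b) ((2 * k - 1) * Real.exp (9 * θ ^ 2))
    (whG_exp hk x y hxy θ hθ) (mul_nonneg (by linarith) (Real.exp_pos _).le) n z
  have h2 : ∑ v ∈ B, Real.exp (c * n) ≤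
      ∑ v ∈ whT n z, Real.exp (whSum (fun a b => θ * whG x y a b) z v) := by
    calc _ ≤ ∑ v ∈ B, Real.exp (whSum (fun a b => θ * whG x y a b) z v) := by
          refine Finset.sum_le_sum fun v hv => ?_
          rw [hB, Finset.mem_filter] at hv
          obtain ⟨hv1, hv2, hv3⟩ := hv
          have hl := ((mem_whT _ _ _).1 hv1).1
          rw [whSum_eq, hv2, hl]
          apply Real.exp_le_exp.2
          linarith
      _ ≤ _ := Finset.sum_le_sum_of_subset_of_nonneg (Finset.filter_subset _ _)
          (fun _ _ _ => (Real.exp_pos _).le)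
  rw [Finset.sum_const, nsmul_eq_mul] at h2
  have h3 := h2.trans h1
  have h4 : Real.exp (9 * θ ^ 2 - c) ^ n = Real.exp (9 * θ ^ 2) ^ n / Real.exp (c * n) := by
    rw [Real.exp_sub, div_pow, ← Real.exp_nat_mul c, mul_comm (n:ℝ) c]
  rw [h4, ← mul_div_assoc, ← mul_pow, le_div_iff₀ (Real.exp_pos _)]
  exact h3

lemma wh_red_iff {k : ℕ} (w : List (Letter k)) :
    FreeGroup.reduce w = w ↔ List.IsChain (fun a b => b ≠ linv a) w := by
  rw [← FreeGroup.isReduced_iff_reduce_eq, FreeGroup.IsReduced]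
  have : (fun a b : Letter k => a.1 = b.1 → a.2 = b.2) = (fun a b => b ≠ linv a) := by
    funext a b
    obtain ⟨i, p⟩ := a
    obtain ⟨j, q⟩ := b
    simp only [linv, ne_eq, Prod.mk.injEq, not_and, eq_iff_iff]
    constructor
    · intro h1 h2 h3
      have := h1 h2.symm
      subst this
      cases p <;> simp at h3
    · intro h1 h2
      have := h1 h2.symm
      cases p <;> cases q <;> simp_all
  rw [this]

def whC (k n : ℕ) : Set (FG k) := {g ∈ Cset k | wordLength g = n}

lemma whC_finite (k n : ℕ) : (whC k n).Finite := by
  apply Set.Finite.of_finite_image (f := FreeGroup.toWord) _ FreeGroup.toWord_injective.injOn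
  refine (List.finite_length_eq (Letter k) n).subset ?_
  rintro _ ⟨g, hg, rfl⟩
  exact hg.2

lemma whC_lower {k : ℕ} (hk : 2 ≤ k) (m : ℕ) :
    (2 * (k:ℝ) - 1) ^ m ≤ ((whC k (m + 2)).ncard : ℝ) := by
  let z : Letter k := (⟨0, by omega⟩, true)
  have hc : ∀ l : Letter k, ∃ c : Letter k, c ≠ linv z ∧ c ≠ linv l := by
    intro l
    have : (({linv z, linv l} : Finset (Letter k))).card < (Finset.univ : Finset (Letter k)).card := by
      refine lt_of_le_of_lt Finset.card_le_two ?_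
      simp only [Finset.card_univ, Fintype.card_prod, Fintype.card_fin, Fintype.card_bool]
      omega
    obtain ⟨c, _, hc⟩ := Finset.exists_mem_notMem_of_card_lt_card this
    simp at hc
    exact ⟨c, hc.1, hc.2⟩
  choose c hc1 hc2 using hc
  let W : List (Letter k) → List (Letter k) := fun v =>
    z :: v ++ [c ((z :: v).getLast (by simp))]
  have hW : ∀ v ∈ whT m z, List.IsChain (fun a b => b ≠ linv a) (W v) ∧
      List.IsChain (fun a b => b ≠ linv a) (W v ++ W v) := by
    intro v hv
    have h1 := ((mem_whT _ _ _).1 hv).2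
    have h2 : List.IsChain (fun a b => b ≠ linv a) (W v) := by
      simp only [W]
      rw [List.isChain_append]
      refine ⟨h1, by simp, ?_⟩
      intro a ha b hb
      rw [List.getLast?_eq_getLast_of_ne_nil (by simp)] at ha
      simp only [Option.mem_def, Option.some.injEq, List.head?_cons] at ha hb
      subst ha; subst hb
      exact hc2 _
    refine ⟨h2, ?_⟩
    rw [List.isChain_append]
    refine ⟨h2, h2, ?_⟩
    intro a ha b hb
    simp only [W, List.getLast?_concat, Option.mem_def, Option.some.injEq] at ha
    simp [W] at hb
    subst ha; subst hb
    intro h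
    exact hc1 _ ((linv_eq_iff _ _).1 h.symm)
  have hword : ∀ v ∈ whT m z, (FreeGroup.mk (W v)).toWord = W v := by
    intro v hv
    rw [FreeGroup.toWord_mk]
    exact (wh_red_iff _).2 (hW v hv).1
  have := Set.ncard_le_ncard_of_injOn (s := (↑(whT m z) : Set (List (Letter k))))
    (t := whC k (m+2)) (fun v => FreeGroup.mk (W v)) ?_ ?_ (whC_finite k (m+2))
  · rw [Set.ncard_coe_finset] at this
    rw [← card_whT m z]
    exact_mod_cast this
  · intro v hv
    have hv' : v ∈ whT m z := hv
    refine ⟨?_, ?_⟩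
    · show FreeGroup.reduce _ = _
      rw [hword v hv']
      exact (wh_red_iff _).2 (hW v hv).2
    · unfold wordLength
      rw [hword v hv']
      simp [W, ((mem_whT _ _ _).1 hv').1]
  · intro v hv v' hv' h
    have h2 : (FreeGroup.mk (W v)).toWord = (FreeGroup.mk (W v')).toWord := by
      simp only at h
      rw [h]
    rw [hword v hv, hword v' hv'] at h2
    have h3 := congrArg List.dropLast h2
    simp only [W, List.dropLast_concat] at h3
    simpa using h3

def whGood (k n : ℕ) (ε : ℝ) : Set (FG k) := {g : FG k | IsCyclicallyReduced g ∧ wordLength g = n ∧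
          ∀ x y : Letter k, y ≠ linv x →
            1 / ((k : ℝ) * (2 * (k : ℝ) - 1)) - ε
              < (whLabel (FreeGroup.toWord g) x y : ℝ) / n ∧
            (whLabel (FreeGroup.toWord g) x y : ℝ) / n
              < 1 / ((k : ℝ) * (2 * (k : ℝ) - 1)) + ε}

lemma whGood_sub (k n : ℕ) (ε : ℝ) : whGood k n ε ⊆ whC k n := fun _ h => ⟨h.1, h.2.1⟩

open Classical in
noncomputable def whB {k : ℕ} (n : ℕ) (c : ℝ) (θ : ℝ) (x y z : Letter k) : Finset (List (Letter k)) :=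
  (whT n z).filter (fun v => (z :: v).getLast (by simp) = z ∧
      c * n ≤ θ * ((countPair (z :: v) x y : ℝ) - 1 / (2 * (k:ℝ) * (2 * k - 1)) * n))

open Classical in
noncomputable def whBU (k n : ℕ) (c t : ℝ) : Finset (List (Letter k)) :=
  ((Finset.univ : Finset ((Letter k × Letter k) × Letter k × Bool)).filter
      (fun i => i.1.2 ≠ linv i.1.1)).biUnion
    (fun i => (whB n c (if i.2.2 then t else -t) i.1.1 i.1.2 i.2.1).image (List.cons i.2.1))

lemma whBU_card {k : ℕ} (hk : 2 ≤ k) (n : ℕ) (c t : ℝ) (ht : |t| ≤ 1 / 3) :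
    ((whBU k n c t).card : ℝ) ≤
      (16 * (k:ℝ) ^ 3) * ((2 * k - 1) ^ n * Real.exp (9 * t ^ 2 - c) ^ n) := by
  classical
  have hk' : (2:ℝ) ≤ k := by exact_mod_cast hk
  have hnn : 0 ≤ ((2 * (k:ℝ) - 1) ^ n * Real.exp (9 * t ^ 2 - c) ^ n) := by
    have : 0 ≤ 2 * (k:ℝ) - 1 := by linarith
    positivity
  calc ((whBU k n c t).card : ℝ) ≤ ∑ i ∈ ((Finset.univ : Finset ((Letter k × Letter k) × Letter k × Bool)).filter
      (fun i => i.1.2 ≠ linv i.1.1)),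
      (((whB n c (if i.2.2 then t else -t) i.1.1 i.1.2 i.2.1).image (List.cons i.2.1)).card : ℝ) := by
        unfold whBU
        exact_mod_cast Finset.card_biUnion_le
    _ ≤ ∑ i ∈ ((Finset.univ : Finset ((Letter k × Letter k) × Letter k × Bool)).filter
      (fun i => i.1.2 ≠ linv i.1.1)), ((2 * (k:ℝ) - 1) ^ n * Real.exp (9 * t ^ 2 - c) ^ n) := by
        refine Finset.sum_le_sum fun i hi => ?_
        have hi' := (Finset.mem_filter.1 hi).2
        refine le_trans (Nat.cast_le.2 Finset.card_image_le) ?_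
        have := whBad_card hk i.1.1 i.1.2 hi' (if i.2.2 then t else -t)
          (by split_ifs <;> simpa using ht) c i.2.1 n
        have h2 : (if i.2.2 then t else -t) ^ 2 = t ^ 2 := by split_ifs <;> ring
        rw [h2] at this
        exact this
    _ ≤ ∑ i : ((Letter k × Letter k) × Letter k × Bool),
          ((2 * (k:ℝ) - 1) ^ n * Real.exp (9 * t ^ 2 - c) ^ n) :=
        Finset.sum_le_sum_of_subset_of_nonneg (Finset.filter_subset _ _) (fun _ _ _ => hnn)
    _ = _ := by
        rw [Finset.sum_const, nsmul_eq_mul]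
        congr 1
        simp only [Finset.card_univ, Fintype.card_prod, Fintype.card_fin, Fintype.card_bool]
        push_cast; ring

lemma whBad_mem {k : ℕ} (hk : 2 ≤ k) (n : ℕ) (hn : 0 < n) (ε t : ℝ) (ht : 0 < t)
    (g : FG k) (hg : g ∈ whC k n \ whGood k n ε) :
    g.toWord ++ g.toWord.take 1 ∈ whBU k n (t * ε / 2) t := by
  have hk' : (2:ℝ) ≤ k := by exact_mod_cast hk
  have hn' : (0:ℝ) < n := by exact_mod_cast hn
  obtain ⟨⟨hg1, hg2⟩, hg3⟩ := hg
  have hlen : g.toWord.length = n := hg2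
  have hcyc : FreeGroup.reduce (g.toWord ++ g.toWord) = g.toWord ++ g.toWord := hg1
  rw [wh_red_iff] at hcyc
  have hlab : ∃ x y : Letter k, y ≠ linv x ∧ ∃ b : Bool,
      t * ε / 2 * n ≤ (if b then t else -t) *
        ((countPair (g.toWord ++ g.toWord.take 1) x y : ℝ)
          - 1 / (2 * (k:ℝ) * (2 * k - 1)) * n) := by
    by_contra hcon
    push Not at hcon
    apply hg3
    refine ⟨hg1, hg2, ?_⟩
    have key : ∀ x y : Letter k, y ≠ linv x →
        -(ε / 2 * n) < (countPair (g.toWord ++ g.toWord.take 1) x y : ℝ)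
          - 1 / (2 * (k:ℝ) * (2 * k - 1)) * n ∧
        (countPair (g.toWord ++ g.toWord.take 1) x y : ℝ)
          - 1 / (2 * (k:ℝ) * (2 * k - 1)) * n < ε / 2 * n := by
      intro x y hxy
      have h1 := hcon x y hxy true
      have h2 := hcon x y hxy false
      simp only [if_true, Bool.false_eq_true, if_false] at h1 h2
      constructor
      · by_contra h
        push Not at h
        nlinarith
      · by_contra h
        push Not at h
        nlinarith
    intro x y hxy
    have hyx : linv x ≠ linv (linv y) := by
      rw [linv_linv]; exact hxy.symm
    have k1 := key x y hxy
    have k2 := key (linv y) (linv x) hyx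
    have hP : 1 / ((k : ℝ) * (2 * (k : ℝ) - 1)) = 2 * (1 / (2 * (k:ℝ) * (2 * k - 1))) := by
      have : 2 * (k:ℝ) - 1 ≠ 0 := by linarith
      field_simp
    rw [hP, lt_div_iff₀ hn', div_lt_iff₀ hn']
    unfold whLabel
    push_cast
    constructor
    · linarith [k1.1, k2.1]
    · linarith [k1.2, k2.2]
  obtain ⟨x, y, hxy, b, hb⟩ := hlab
  generalize hw : g.toWord = w at *
  cases w with
  | nil => simp at hlen; omega
  | cons z u =>
    have e : z :: u ++ (z :: u).take 1 = z :: (u ++ [z]) := by simp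
    rw [e] at hb ⊢
    simp only [whBU, Finset.mem_biUnion, Finset.mem_filter, Finset.mem_univ, true_and,
      Finset.mem_image]
    refine ⟨((x, y), z, b), hxy, u ++ [z], ?_, rfl⟩
    simp only [whB, Finset.mem_filter]
    refine ⟨?_, by simp, hb⟩
    rw [mem_whT]
    refine ⟨by simpa using hlen, ?_⟩
    refine List.IsChain.infix hcyc ⟨[], u, by simp⟩

lemma whBad_ncard {k : ℕ} (hk : 2 ≤ k) (n : ℕ) (hn : 0 < n) (ε t : ℝ) (ht : 0 < t)
    (ht' : t ≤ 1 / 3) :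
    ((whC k n \ whGood k n ε).ncard : ℝ) ≤
      (16 * (k:ℝ) ^ 3) * ((2 * k - 1) ^ n * Real.exp (9 * t ^ 2 - t * ε / 2) ^ n) := by
  refine le_trans ?_ (whBU_card hk n (t * ε / 2) t (by rwa [abs_of_pos ht]))
  have := Set.ncard_le_ncard_of_injOn (s := whC k n \ whGood k n ε)
    (t := (↑(whBU k n (t * ε / 2) t) : Set (List (Letter k))))
    (fun g => g.toWord ++ g.toWord.take 1)
    (fun g hg => whBad_mem hk n hn ε t ht g hg) ?_ (Finset.finite_toSet _)
  · rw [Set.ncard_coe_finset] at this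
    exact_mod_cast this
  · intro g hg g' hg' h
    simp only at h
    have l1 : g.toWord.length = n := hg.1.2
    have l2 : g'.toWord.length = n := hg'.1.2
    exact FreeGroup.toWord_injective (List.append_inj_left h (l1.trans l2.symm))

end WH

/-- for any `ε > 0`, the proportion `Q(n,ε)/γ(n,C)` of cyclically reduced
words of length `n` all of whose weighted Whitehead graph edge labels, divided by `n`,
lie in `(1/(k(2k−1)) − ε, 1/(k(2k−1)) + ε)`, tends to `1` exponentially fast. -/
theorem whGraph_labels_generic (k : ℕ) (hk : 2 ≤ k) (ε : ℝ) (hε : 0 < ε) :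
    ∃ K : ℝ, 0 < K ∧ ∃ σ : ℝ, 0 < σ ∧ σ < 1 ∧ ∀ n : ℕ,
      |1 - ({g : FG k | IsCyclicallyReduced g ∧ wordLength g = n ∧
          ∀ x y : Letter k, y ≠ linv x →
            1 / ((k : ℝ) * (2 * (k : ℝ) - 1)) - ε
              < (whLabel (FreeGroup.toWord g) x y : ℝ) / n ∧
            (whLabel (FreeGroup.toWord g) x y : ℝ) / n
              < 1 / ((k : ℝ) * (2 * (k : ℝ) - 1)) + ε}.ncard : ℝ) /
        (gammaC (Cset k) n : ℝ)| ≤ K * σ ^ n := by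
  have hk' : (2:ℝ) ≤ k := by exact_mod_cast hk
  set t : ℝ := min (1 / 3) (ε / 36) with ht
  have t0 : 0 < t := by rw [ht]; positivity
  have t1 : t ≤ 1 / 3 := min_le_left _ _
  have t2 : t ≤ ε / 36 := min_le_right _ _
  set σ : ℝ := Real.exp (9 * t ^ 2 - t * ε / 2) with hσ
  have σ0 : 0 < σ := Real.exp_pos _
  have σ1 : σ < 1 := by
    rw [hσ, Real.exp_lt_one_iff]
    nlinarith [mul_pos t0 hε]
  have hB : 0 ≤ 16 * (k:ℝ) ^ 3 * (2 * k - 1) ^ 2 := by positivity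
  refine ⟨1 / σ + 16 * (k:ℝ) ^ 3 * (2 * k - 1) ^ 2, by positivity, σ, σ0, σ1, ?_⟩
  intro n
  change |1 - ((whGood k n ε).ncard : ℝ) / ((whC k n).ncard : ℝ)| ≤ _
  have hle : (whGood k n ε).ncard ≤ (whC k n).ncard :=
    Set.ncard_le_ncard (whGood_sub k n ε) (whC_finite k n)
  have hle' : ((whGood k n ε).ncard : ℝ) ≤ ((whC k n).ncard : ℝ) := by exact_mod_cast hle
  have hd0 : 0 ≤ ((whGood k n ε).ncard : ℝ) / ((whC k n).ncard : ℝ) := by positivity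
  have hd1 : ((whGood k n ε).ncard : ℝ) / ((whC k n).ncard : ℝ) ≤ 1 :=
    div_le_one_of_le₀ hle' (by positivity)
  rw [abs_of_nonneg (by linarith)]
  have hsn : 0 < σ ^ n := by positivity
  rcases Nat.lt_or_ge n 2 with h | h
  · have : 1 ≤ 1 / σ * σ ^ n := by
      interval_cases n
      · simp only [pow_zero, mul_one]
        rw [le_div_iff₀ σ0]; linarith
      · rw [pow_one, one_div, inv_mul_cancel₀ σ0.ne']
    nlinarith
  · obtain ⟨m, rfl⟩ : ∃ m, n = m + 2 := ⟨n - 2, by omega⟩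
    have hlow := whC_lower hk m
    have hpos : 0 < (2 * (k:ℝ) - 1) ^ m := by
      have : 0 < 2 * (k:ℝ) - 1 := by linarith
      positivity
    have hC : 0 < ((whC k (m+2)).ncard : ℝ) := by linarith
    have hbad := whBad_ncard hk (m+2) (by omega) ε t t0 t1
    have hdiff := Set.ncard_sdiff_add_ncard_of_subset (whGood_sub k (m+2) ε) (whC_finite k (m+2))
    have hdiff' : ((whC k (m+2) \ whGood k (m+2) ε).ncard : ℝ) + ((whGood k (m+2) ε).ncard : ℝ)
      = ((whC k (m+2)).ncard : ℝ) := by exact_mod_cast hdiff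
    have e : 1 - ((whGood k (m+2) ε).ncard : ℝ) / ((whC k (m+2)).ncard : ℝ)
        = ((whC k (m+2) \ whGood k (m+2) ε).ncard : ℝ) / ((whC k (m+2)).ncard : ℝ) := by
      rw [eq_div_iff hC.ne', sub_mul, div_mul_cancel₀ _ hC.ne']; linarith
    rw [e, div_le_iff₀ hC]
    calc _ ≤ _ := hbad
      _ = (16 * (k:ℝ) ^ 3 * (2 * k - 1) ^ 2) * σ ^ (m+2) * (2 * (k:ℝ) - 1) ^ m := by
        rw [← hσ]; ring
      _ ≤ (16 * (k:ℝ) ^ 3 * (2 * k - 1) ^ 2) * σ ^ (m+2) * ((whC k (m+2)).ncard : ℝ) := by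
        gcongr
      _ ≤ _ := by
        gcongr
        have : 0 < 1 / σ := by positivity
        linarith
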